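/- arXiv:2407.10556 — 2 statements merged into one kernel-verified Lean document; each statement's English description precedes it below -/
import Mathlib

section
/- Let G = (V, E) be an equatorial graph that is δ-regular with girth 3 and equator q. Then q ≡ 0 (mod 3) or δ ≡ 2 (mod 3). Moreover V can be partitioned into q parts L_0, …, L_{q−1} such that each part induces a clique, and E consists exactly of these clique edges together with all edges uv with u ∈ L_i and v ∈ L_{i+1} (subscripts mod q); if q ≡ 0 (mod 3) then there are positive integers n_0, n_1, n_2 with n_0 + n_1 + n_2 = δ + 1 and |L_i| = n_j whenever i ≡ j (mod 3), and if q ≢ 0 (mod 3) then |L_i| = (δ+1)/3 for all i. -/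
open SimpleGraph

/-- The distance between two indices around a cycle of length `q`. -/
def cycleDist {q : ℕ} (i j : ZMod q) : ℕ := min (i - j).val (j - i).val

/-- `f` lists the vertices (in cyclic order) of an isometric cycle of length `q` in `G`:
the distance in `G` between any two of its vertices equals their distance along the cycle. -/
def IsIsoCycle {V : Type*} (G : SimpleGraph V) (q : ℕ) (f : ZMod q → V) : Prop :=
  3 ≤ q ∧ ∀ i j : ZMod q, G.dist (f i) (f j) = cycleDist i j

/-- `G` has an isometric cycle of length `q`. -/
def HasIsoCycle {V : Type*} (G : SimpleGraph V) (q : ℕ) : Prop :=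
  ∃ f : ZMod q → V, IsIsoCycle G q f

/-- The equator of `G` is `q`: `q` is the length of a longest isometric cycle of `G`
(`0` if `G` has no isometric cycle, e.g. if `G` is acyclic). -/
def IsEquator {V : Type*} (G : SimpleGraph V) (q : ℕ) : Prop :=
  (HasIsoCycle G q ∨ (q = 0 ∧ ∀ q', ¬ HasIsoCycle G q')) ∧ ∀ q', HasIsoCycle G q' → q' ≤ q

/-- The degree of a vertex, as the cardinality of its neighbor set. -/
noncomputable def ndeg {V : Type*} (G : SimpleGraph V) (v : V) : ℕ := (G.neighborSet v).ncard

/-- `G` has minimum degree `δ`. -/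
def HasMinDegree {V : Type*} (G : SimpleGraph V) (δ : ℕ) : Prop :=
  (∀ v, δ ≤ ndeg G v) ∧ ∃ v, ndeg G v = δ

/-- The Moore bound `M(δ, g)`. -/
def mooreBound (δ g : ℕ) : ℕ :=
  if Odd g then 1 + δ * ∑ i ∈ Finset.range ((g + 1) / 2 - 1), (δ - 1) ^ i
  else 2 + ∑ i ∈ Finset.Icc 1 ((g + 1) / 2 - 1), 2 * (δ - 1) ^ i

/-- The disk of radius `k` around a vertex `u`. -/
def disk {V : Type*} (G : SimpleGraph V) (k : ℕ) (u : V) : Set V := {v | G.dist u v ≤ k}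

/-- The disk of radius `k` around an edge `uv`. -/
def edisk {V : Type*} (G : SimpleGraph V) (k : ℕ) (u v : V) : Set V :=
  disk G k u ∪ disk G k v

/-- `G` is an equatorial graph with minimum degree `δ`, girth `g` and equator `q`:
a finite connected simple graph with girth `g`, minimum degree `δ`, equator `q > 6k + 3`
(where `k = ⌈g/2⌉ - 1`) whose order attains the bound `n = (q/g) · M(δ, g)`. -/
def IsEquatorial {V : Type*} (G : SimpleGraph V) (δ g q : ℕ) : Prop :=
  Finite V ∧ G.Connected ∧ G.girth = g ∧ HasMinDegree G δ ∧ IsEquator G q ∧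
    6 * ((g + 1) / 2 - 1) + 3 < q ∧ g * Nat.card V = q * mooreBound δ g

/-- The part `L i` of the partition induced by the isometric cycle `f`:
`L i = D_k(u_{i-k}) ∩ D_k(u_{i+k})`. -/
def Lpart {V : Type*} (G : SimpleGraph V) (k : ℕ) {q : ℕ} (f : ZMod q → V) (i : ZMod q) :
    Set V :=
  disk G k (f (i - (k : ZMod q))) ∩ disk G k (f (i + (k : ZMod q)))

lemma exists_int_of_cycleDist_le {q : ℕ} [NeZero q] {i j : ZMod q} {m : ℕ}
    (h : cycleDist i j ≤ m) : ∃ e : ℤ, -(m : ℤ) ≤ e ∧ e ≤ m ∧ j = i + e := by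
  rcases min_le_iff.1 h with h | h
  · refine ⟨-((i - j).val : ℤ), by omega, by omega, ?_⟩
    simp
  · refine ⟨((j - i).val : ℤ), by omega, by omega, ?_⟩
    simp

lemma ZMod.intCast_inj_of_abs_sub_lt {q : ℕ} {a b : ℤ} (h : (a : ZMod q) = b)
    (hab : |a - b| < q) : a = b := by
  have h' : ((a - b : ℤ) : ZMod q) = 0 := by simp [h]
  rw [ZMod.intCast_zmod_eq_zero_iff_dvd] at h'
  exact sub_eq_zero.1 (Int.eq_zero_of_abs_lt_dvd h' hab)

lemma cycleDist_add_one_le {q : ℕ} [Fact (1 < q)] (i : ZMod q) : cycleDist i (i + 1) ≤ 1 := by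
  simp [cycleDist, ZMod.val_one]

lemma cycleDist_comm {q : ℕ} (i j : ZMod q) : cycleDist i j = cycleDist j i := min_comm _ _

/-- A set of residues modulo `q ≥ 7` with pairwise cyclic distances at most `2` is contained in
three consecutive residues. -/
lemma exists_subset_consecutive {q : ℕ} [NeZero q] (hq : 7 ≤ q) (S : Finset (ZMod q))
    (hS : ∀ i ∈ S, ∀ j ∈ S, cycleDist i j ≤ 2) : ∃ i : ZMod q, S ⊆ {i - 1, i, i + 1} := by
  rcases S.eq_empty_or_nonempty with rfl | ⟨a, ha⟩
  · exact ⟨0, by simp⟩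
  have near : ∀ j ∈ S, ∃ e : ℤ, -2 ≤ e ∧ e ≤ 2 ∧ j = a + e := fun j hj ↦
    exists_int_of_cycleDist_le (hS a ha j hj)
  have close : ∀ x y : ℤ, a + x ∈ S → a + y ∈ S → -2 ≤ x → y ≤ 2 → y ≤ x + 2 := by
    intro x y hx hy h1 h2
    by_contra hlt
    obtain ⟨e, he1, he2, he⟩ := exists_int_of_cycleDist_le (hS _ hx _ hy)
    have he' : ((y : ℤ) : ZMod q) = ((x + e : ℤ) : ZMod q) := by
      push_cast; linear_combination he
    have := ZMod.intCast_inj_of_abs_sub_lt he' (by rw [abs_lt]; push_cast at *; omega)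
    push_cast at *; omega
  obtain ⟨b, hb⟩ : ∃ b : ℤ, ∀ j ∈ S, ∃ e : ℤ, b - 1 ≤ e ∧ e ≤ b + 1 ∧ j = a + e := by
    by_cases h2 : a + ((-2 : ℤ) : ZMod q) ∈ S
    · refine ⟨-1, fun j hj ↦ ?_⟩
      obtain ⟨e, he1, he2, rfl⟩ := near j hj
      exact ⟨e, by omega, by have := close _ _ h2 hj le_rfl he2; omega, rfl⟩
    by_cases h1 : a + ((-1 : ℤ) : ZMod q) ∈ S
    · refine ⟨0, fun j hj ↦ ?_⟩
      obtain ⟨e, he1, he2, rfl⟩ := near j hj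
      have : e ≠ -2 := fun h ↦ h2 (h ▸ hj)
      exact ⟨e, by omega, by have := close _ _ h1 hj (by norm_num) he2; omega, rfl⟩
    · refine ⟨1, fun j hj ↦ ?_⟩
      obtain ⟨e, he1, he2, rfl⟩ := near j hj
      have : e ≠ -2 := fun h ↦ h2 (h ▸ hj)
      have : e ≠ -1 := fun h ↦ h1 (h ▸ hj)
      exact ⟨e, by omega, by omega, rfl⟩
  refine ⟨a + b, fun j hj ↦ ?_⟩
  obtain ⟨e, he1, he2, rfl⟩ := hb j hj
  obtain rfl | rfl | rfl : e = b - 1 ∨ e = b ∨ e = b + 1 := by omega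
  all_goals simp [add_assoc, add_sub_assoc]

lemma disk_one_eq_insert {V : Type*} {G : SimpleGraph V} (hG : G.Connected) (u : V) :
    disk G 1 u = insert u (G.neighborSet u) := by
  ext v
  simp only [disk, Set.mem_ofPred_eq, Set.mem_insert_iff, mem_neighborSet]
  rw [Nat.le_one_iff_eq_zero_or_eq_one, hG.dist_eq_zero_iff, dist_eq_one_iff_adj, eq_comm]

lemma ncard_disk_one {V : Type*} [Finite V] {G : SimpleGraph V} (hG : G.Connected) (u : V) :
    (disk G 1 u).ncard = ndeg G u + 1 := by
  rw [disk_one_eq_insert hG, Set.ncard_insert_of_notMem (by simp) (Set.toFinite _), ndeg]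

/-- If the order of a regular graph is a third of the total size of the unit disks along an
isometric cycle, then every vertex lies in exactly three, consecutive, of these disks. -/
lemma exists_index {V : Type*} [Finite V] {G : SimpleGraph V} {δ q : ℕ} [NeZero q]
    (hG : G.Connected) (hq : 7 ≤ q) (hreg : ∀ v, ndeg G v = δ)
    (hn : 3 * Nat.card V = q * (δ + 1)) {f : ZMod q → V} (hf : IsIsoCycle G q f) :
    ∃ c : V → ZMod q, ∀ v j, v ∈ disk G 1 (f j) ↔ j = c v - 1 ∨ j = c v ∨ j = c v + 1 := by
  classical
  have := Fintype.ofFinite V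
  let S : V → Finset (ZMod q) := fun v ↦ {j | v ∈ disk G 1 (f j)}
  have hS : ∀ v, ∃ i : ZMod q, S v ⊆ {i - 1, i, i + 1} := by
    refine fun v ↦ exists_subset_consecutive hq _ fun i hi j hj ↦ ?_
    replace hi : G.dist (f i) v ≤ 1 := (Finset.mem_filter.1 hi).2
    replace hj : G.dist (f j) v ≤ 1 := (Finset.mem_filter.1 hj).2
    rw [← hf.2]
    have := hG.dist_triangle (u := f i) (v := v) (w := f j)
    rw [G.dist_comm (u := v)] at this
    omega
  choose c hc using hS
  have hle : ∀ v ∈ Finset.univ, (S v).card ≤ 3 := fun v _ ↦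
    (Finset.card_le_card (hc v)).trans Finset.card_le_three
  have hsum : ∑ v, (S v).card = ∑ _v : V, 3 := by
    have h := Finset.sum_card_bipartiteAbove_eq_sum_card_bipartiteBelow
      (s := (Finset.univ : Finset V)) (t := (Finset.univ : Finset (ZMod q)))
      (fun v j ↦ v ∈ disk G 1 (f j))
    have hd : ∀ j, (Finset.bipartiteBelow (fun v j ↦ v ∈ disk G 1 (f j)) Finset.univ j).card
        = δ + 1 := by
      intro j
      rw [← hreg (f j), ← ncard_disk_one hG, ← Set.ncard_coe_finset]
      simp [Finset.bipartiteBelow]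
    rw [Finset.sum_congr rfl fun j _ ↦ hd j] at h
    refine h.trans ?_
    simp only [Finset.sum_const, Finset.card_univ, ZMod.card, smul_eq_mul]
    rw [← hn, Nat.card_eq_fintype_card, mul_comm]
  have heq := (Finset.sum_eq_sum_iff_of_le hle).1 hsum
  refine ⟨c, fun v j ↦ ?_⟩
  have := Finset.eq_of_subset_of_card_le (hc v)
    (Finset.card_le_three.trans (heq v (Finset.mem_univ v)).ge)
  simpa [S] using Finset.ext_iff.1 this j

lemma mem_consecutive_iff {q : ℕ} {i j : ZMod q} :
    (j = i - 1 ∨ j = i ∨ j = i + 1) ↔ ∃ e : ℤ, -1 ≤ e ∧ e ≤ 1 ∧ j = i + e := by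
  constructor
  · rintro (rfl | rfl | rfl)
    · exact ⟨-1, by simp [sub_eq_add_neg]⟩
    · exact ⟨0, by simp⟩
    · exact ⟨1, by simp⟩
  · rintro ⟨e, h1, h2, rfl⟩
    obtain rfl | rfl | rfl : e = -1 ∨ e = 0 ∨ e = 1 := by omega
    all_goals simp [sub_eq_add_neg]

section Index

variable {V : Type*} {G : SimpleGraph V} {q : ℕ} {f : ZMod q → V} {c : V → ZMod q}

lemma adj_index [NeZero q] (hG : G.Connected) (hq : 9 < q) (hf : IsIsoCycle G q f)
    (hc : ∀ v j, v ∈ disk G 1 (f j) ↔ j = c v - 1 ∨ j = c v ∨ j = c v + 1) {u v : V}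
    (huv : G.Adj u v) : c v = c u - 1 ∨ c v = c u ∨ c v = c u + 1 := by
  have key : ∀ i j, u ∈ disk G 1 (f i) → v ∈ disk G 1 (f j) → cycleDist i j ≤ 3 := by
    intro i j hi hj
    simp only [disk, Set.mem_ofPred_eq] at hi hj
    rw [← hf.2]
    have h1 := hG.dist_triangle (u := f i) (v := u) (w := f j)
    have h2 := hG.dist_triangle (u := u) (v := v) (w := f j)
    rw [dist_eq_one_iff_adj.2 huv, G.dist_comm (u := v)] at h2
    omega
  obtain ⟨e, he1, he2, he⟩ := exists_int_of_cycleDist_le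
    (key (c u) (c v) ((hc _ _).2 (by simp)) ((hc _ _).2 (by simp)))
  obtain ⟨a, ha1, ha2, ha⟩ := exists_int_of_cycleDist_le
    (key (c u - 1) (c v + 1) ((hc _ _).2 (by simp)) ((hc _ _).2 (by simp)))
  obtain ⟨b, hb1, hb2, hb⟩ := exists_int_of_cycleDist_le
    (key (c u + 1) (c v - 1) ((hc _ _).2 (by simp)) ((hc _ _).2 (by simp)))
  have ha' : ((a : ℤ) : ZMod q) = ((e + 2 : ℤ) : ZMod q) := by
    push_cast; linear_combination he - ha
  have hb' : ((b : ℤ) : ZMod q) = ((e - 2 : ℤ) : ZMod q) := by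
    push_cast; linear_combination he - hb
  have ha'' := ZMod.intCast_inj_of_abs_sub_lt ha' (by rw [abs_lt]; push_cast at *; omega)
  have hb'' := ZMod.intCast_inj_of_abs_sub_lt hb' (by rw [abs_lt]; push_cast at *; omega)
  push_cast at *
  exact mem_consecutive_iff.2 ⟨e, by omega, by omega, he⟩

lemma adj_iff_index [NeZero q] [Finite V] {δ : ℕ} (hG : G.Connected) (hq : 9 < q)
    (hreg : ∀ v, ndeg G v = δ) (hf : IsIsoCycle G q f)
    (hc : ∀ v j, v ∈ disk G 1 (f j) ↔ j = c v - 1 ∨ j = c v ∨ j = c v + 1) {u v : V}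
    (huv : u ≠ v) : G.Adj u v ↔ c v = c u - 1 ∨ c v = c u ∨ c v = c u + 1 := by
  refine ⟨adj_index hG hq hf hc, fun h ↦ ?_⟩
  have swap : ∀ i j : ZMod q, (i = j - 1 ∨ i = j ∨ i = j + 1) → j = i - 1 ∨ j = i ∨ j = i + 1 := by
    rintro i j (rfl | rfl | rfl) <;> simp
  have hsub : disk G 1 u ⊆ disk G 1 (f (c u)) := by
    rw [disk_one_eq_insert hG u]
    rintro w (rfl | hw)
    · exact (hc _ _).2 (by simp)
    · exact (hc _ _).2 (swap _ _ (adj_index hG hq hf hc hw))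
  have heq := Set.eq_of_subset_of_ncard_le hsub
    (by rw [ncard_disk_one hG, ncard_disk_one hG, hreg, hreg]) (Set.toFinite _)
  have hv : v ∈ disk G 1 u := heq ▸ (hc _ _).2 (swap _ _ h)
  rw [disk_one_eq_insert hG u] at hv
  exact hv.resolve_left huv.symm

lemma index_apply (hq : 9 < q) (hf : IsIsoCycle G q f)
    (hc : ∀ v j, v ∈ disk G 1 (f j) ↔ j = c v - 1 ∨ j = c v ∨ j = c v + 1) (i : ZMod q) :
    c (f i) = i := by
  have : Fact (1 < q) := ⟨by omega⟩
  have h1 : f i ∈ disk G 1 (f (i + 1)) := by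
    simpa [disk, hf.2, cycleDist_comm] using cycleDist_add_one_le i
  have h2 : f i ∈ disk G 1 (f (i - 1)) := by
    have h := cycleDist_add_one_le (i - 1)
    rw [sub_add_cancel] at h
    simpa [disk, hf.2] using h
  rw [hc, mem_consecutive_iff] at h1 h2
  obtain ⟨a, ha1, ha2, ha⟩ := h1
  obtain ⟨b, hb1, hb2, hb⟩ := h2
  have hab : ((a : ℤ) : ZMod q) = ((b + 2 : ℤ) : ZMod q) := by
    push_cast; linear_combination hb - ha
  have hab' := ZMod.intCast_inj_of_abs_sub_lt hab (by rw [abs_lt]; push_cast at *; omega)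
  obtain rfl : a = 1 := by omega
  simpa using ha.symm

lemma ncard_index_sum [Finite V] {δ : ℕ} (hG : G.Connected) (hq : 9 < q)
    (hreg : ∀ v, ndeg G v = δ)
    (hc : ∀ v j, v ∈ disk G 1 (f j) ↔ j = c v - 1 ∨ j = c v ∨ j = c v + 1) (i : ZMod q) :
    (c ⁻¹' {i}).ncard + (c ⁻¹' {i + 1}).ncard + (c ⁻¹' {i + 2}).ncard = δ + 1 := by
  have hne : ∀ a b : ℤ, 0 ≤ a → a < b → b ≤ 2 → i + a ≠ i + b := by
    intro a b h0 h1 h2 h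
    have := ZMod.intCast_inj_of_abs_sub_lt (add_left_cancel h) (by rw [abs_lt]; omega)
    omega
  have h01 : i ≠ i + 1 := by simpa using hne 0 1 (by simp) (by simp) (by simp)
  have h02 : i ≠ i + 2 := by simpa using hne 0 2 (by simp) (by simp) (by simp)
  have h12 : i + 1 ≠ i + 2 := by simpa using hne 1 2 (by simp) (by simp) (by simp)
  have hu : disk G 1 (f (i + 1)) = c ⁻¹' {i} ∪ c ⁻¹' {i + 1} ∪ c ⁻¹' {i + 2} := by
    ext v
    simp only [hc, Set.mem_union, Set.mem_preimage, Set.mem_singleton_iff]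
    constructor
    · rintro (h | h | h)
      · right; linear_combination -h
      · left; right; exact h.symm
      · left; left; linear_combination -h
    · rintro ((h | h) | h)
      · right; right; rw [h]
      · right; left; exact h.symm
      · left; rw [h]; ring
  rw [← hreg (f (i + 1)), ← ncard_disk_one hG, hu, Set.ncard_union_eq, Set.ncard_union_eq]
  · exact Set.disjoint_left.2 fun v h h' ↦ h01 (h.symm.trans h')
  · refine Set.disjoint_left.2 ?_
    rintro v (h | h) h'
    · exact h02 (h.symm.trans h')
    · exact h12 (h.symm.trans h')

end Index

/-- A function on `ZMod q` with period `3` is constant if `3 ∤ q`. -/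
lemma eq_of_periodic_three {q : ℕ} [NeZero q] {α : Type*} {a : ZMod q → α}
    (ha : ∀ i, a (i + 3) = a i) (hq : q % 3 ≠ 0) (i j : ZMod q) : a i = a j := by
  have hmul : ∀ (n : ℕ) (i : ZMod q), a (i + 3 * n) = a i := by
    intro n
    induction n with
    | zero => simp
    | succ n ih =>
      intro i
      rw [← ih i, ← ha (i + 3 * n)]
      push_cast; ring_nf
  have h3 : IsUnit ((3 : ℕ) : ZMod q) := by
    rw [ZMod.isUnit_iff_coprime, Nat.Prime.coprime_iff_not_dvd Nat.prime_three]
    omega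
  obtain ⟨x, hx⟩ := h3.dvd (a := i - j)
  have := hmul x.val j
  rw [ZMod.natCast_val, ZMod.cast_id] at this
  rw [← this]
  congr 1
  push_cast at hx
  linear_combination hx

/-- Theorem 7.1: characterization of equatorial graphs with girth 3. -/
theorem stmt_18 {V : Type*} (G : SimpleGraph V) (δ q : ℕ)
    (hG : IsEquatorial G δ 3 q) (hreg : ∀ v : V, ndeg G v = δ) :
    (q % 3 = 0 ∨ δ % 3 = 2) ∧
    ∃ L : ZMod q → Set V,
      (∀ v : V, ∃! i : ZMod q, v ∈ L i) ∧
      (∀ i : ZMod q, ∀ u ∈ L i, ∀ v ∈ L i, u ≠ v → G.Adj u v) ∧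
      (∀ u v : V, G.Adj u v ↔
        ((∃ i : ZMod q, u ∈ L i ∧ v ∈ L i ∧ u ≠ v) ∨
          (∃ i : ZMod q, (u ∈ L i ∧ v ∈ L (i + 1)) ∨ (v ∈ L i ∧ u ∈ L (i + 1))))) ∧
      (q % 3 = 0 → ∃ n0 n1 n2 : ℕ, 0 < n0 ∧ 0 < n1 ∧ 0 < n2 ∧
        n0 + n1 + n2 = δ + 1 ∧
        ∀ i : ℕ, i < q →
          ((i % 3 = 0 → (L (i : ZMod q)).ncard = n0) ∧
           (i % 3 = 1 → (L (i : ZMod q)).ncard = n1) ∧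
           (i % 3 = 2 → (L (i : ZMod q)).ncard = n2))) ∧
      (q % 3 ≠ 0 → ∀ i : ZMod q, 3 * (L i).ncard = δ + 1) := by
  obtain ⟨_, hconn, -, -, ⟨hiso, -⟩, hq9, hn⟩ := hG
  replace hq9 : 9 < q := by simpa using hq9
  have : NeZero q := ⟨by omega⟩
  obtain ⟨f, hf⟩ : HasIsoCycle G q := hiso.resolve_right (by omega)
  have hmoore : mooreBound δ 3 = δ + 1 := by
    simp [mooreBound, show Odd 3 by decide, add_comm]
  rw [hmoore] at hn
  obtain ⟨c, hc⟩ := exists_index hconn (by omega) hreg hn hf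
  have hadj : ∀ {u v}, u ≠ v → (G.Adj u v ↔ c v = c u - 1 ∨ c v = c u ∨ c v = c u + 1) :=
    adj_iff_index hconn hq9 hreg hf hc
  have hsum := ncard_index_sum hconn hq9 hreg hc
  have hper : ∀ i : ZMod q, (c ⁻¹' {i + 3}).ncard = (c ⁻¹' {i}).ncard := by
    intro i
    have h1 := hsum i
    have h2 := hsum (i + 1)
    rw [show i + 1 + 1 = i + 2 by ring, show i + 1 + 2 = i + 3 by ring] at h2
    omega
  have hpos : ∀ i, 0 < (c ⁻¹' {i}).ncard := fun i ↦
    (Set.ncard_pos (Set.toFinite _)).2 ⟨f i, index_apply hq9 hf hc i⟩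
  have hconst : q % 3 ≠ 0 → ∀ i : ZMod q, 3 * (c ⁻¹' {i}).ncard = δ + 1 := by
    intro h i
    have := eq_of_periodic_three (a := fun i ↦ (c ⁻¹' {i}).ncard) hper h
    have h1 := this (i + 1) i
    have h2 := this (i + 2) i
    have h3 := hsum i
    omega
  have hone : (1 : ZMod q) ≠ 0 := fun h ↦ by
    have : ((1 : ℤ) : ZMod q) = ((0 : ℤ) : ZMod q) := by simpa using h
    have := ZMod.intCast_inj_of_abs_sub_lt this (by rw [abs_lt]; omega)
    omega
  refine ⟨?_, fun i ↦ c ⁻¹' {i}, fun v ↦ ⟨c v, rfl, fun _ h ↦ h.symm⟩, ?_, ?_, ?_, hconst⟩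
  · by_contra! h
    have := hconst h.1 0
    omega
  · intro i u hu v hv huv
    exact (hadj huv).2 (.inr (.inl (Eq.trans hv hu.symm)))
  · intro u v
    simp only [Set.mem_preimage, Set.mem_singleton_iff, exists_or, exists_eq_left']
    by_cases huv : u = v
    · subst huv
      simp [hone]
    rw [hadj huv]
    constructor
    · rintro (h | h | h)
      · exact .inr (.inr (by rw [h]; ring))
      · exact .inl ⟨h, huv⟩
      · exact .inr (.inl h)
    · rintro (⟨h, -⟩ | h | h)
      · exact .inr (.inl h)
      · exact .inr (.inr h)
      · exact .inl (by rw [h]; ring)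
  · intro _
    have hmod : ∀ m r : ℕ,
        (c ⁻¹' {((3 * m + r : ℕ) : ZMod q)}).ncard = (c ⁻¹' {(r : ZMod q)}).ncard := by
      intro m r
      induction m with
      | zero => simp
      | succ m ih =>
        rw [← ih, ← hper ((3 * m + r : ℕ) : ZMod q)]
        push_cast; ring_nf
    refine ⟨_, _, _, hpos (0 : ℕ), hpos (1 : ℕ), hpos (2 : ℕ), ?_, fun i _ ↦ ?_⟩
    · simpa using hsum 0
    · have h := hmod (i / 3) (i % 3)
      rw [Nat.div_add_mod] at h
      exact ⟨fun hi ↦ by rw [h, hi], fun hi ↦ by rw [h, hi], fun hi ↦ by rw [h, hi]⟩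
end

section
/- Let G = (V, E) be an equatorial graph that is δ-regular with girth 4 and equator q. Then q ≡ 0 (mod 4) or δ ≡ 0 (mod 2). Moreover V can be partitioned into q parts L_0, …, L_{q−1}, each an independent set, such that E consists exactly of all edges uv with u ∈ L_i and v ∈ L_{i+1} (subscripts mod q); if q ≡ 0 (mod 4) then there are positive integers n_0, n_1, n_2, n_3 with n_0 + n_2 = δ = n_1 + n_3 and |L_i| = n_j whenever i ≡ j (mod 4), and if q ≢ 0 (mod 4) then |L_i| = δ/2 for all i. -/
open SimpleGraph

theorem intCast_zmod_inj_of_abs_sub_lt {q : ℕ} {a b : ℤ} (h : |a - b| < q)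
    (hab : (a : ZMod q) = b) : a = b := by
  have hdvd : (q : ℤ) ∣ a - b := by
    rw [← ZMod.intCast_zmod_eq_zero_iff_dvd]
    push_cast
    rw [hab, sub_self]
  have := Int.eq_zero_of_abs_lt_dvd hdvd h
  omega

theorem exists_intCast_eq_sub_of_cycleDist_le {q m : ℕ} [NeZero q] {i j : ZMod q}
    (h : cycleDist i j ≤ m) : ∃ c : ℤ, |c| ≤ m ∧ i - j = c := by
  rcases min_le_iff.1 h with h | h
  · exact ⟨(i - j).val, by rw [Nat.abs_cast]; exact_mod_cast h, by simp⟩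
  · refine ⟨-(j - i).val, by rw [abs_neg, Nat.abs_cast]; exact_mod_cast h, ?_⟩
    push_cast
    rw [ZMod.natCast_zmod_val]
    ring

theorem cycleDist_add_one {q : ℕ} (hq : 1 < q) (i : ZMod q) : cycleDist i (i + 1) = 1 := by
  have : Fact (1 < q) := ⟨hq⟩
  have hneg : (-1 : ZMod q).val ≠ 0 := by simp
  have h₁ : i - (i + 1) = -1 := by ring
  have h₂ : i + 1 - i = 1 := by ring
  rw [cycleDist, h₁, h₂, ZMod.val_one]
  omega

theorem SimpleGraph.not_adj_of_three_lt_girth {V : Type*} {G : SimpleGraph V}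
    (hg : 3 < G.girth) {u v w : V} (huv : G.Adj u v) (huw : G.Adj u w) : ¬ G.Adj v w := by
  classical
  intro hvw
  obtain ⟨x, p, hp, hlen⟩ := is3Clique_iff_exists_cycle_length_three.1
    ⟨{u, v, w}, is3Clique_triple_iff.2 ⟨huv, huw, hvw⟩⟩
  have := girth_le_length hp
  omega

section IsoCycle

variable {V : Type*} {G : SimpleGraph V} {q : ℕ} {f : ZMod q → V}

theorem IsIsoCycle.adj_add_one (hf : IsIsoCycle G q f) (i : ZMod q) :
    G.Adj (f i) (f (i + 1)) := by
  rw [← dist_eq_one_iff_adj, hf.2, cycleDist_add_one (by have := hf.1; omega)]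

theorem IsIsoCycle.adj_sub_one (hf : IsIsoCycle G q f) (i : ZMod q) :
    G.Adj (f i) (f (i - 1)) := by
  simpa using (hf.adj_add_one (i - 1)).symm

theorem IsIsoCycle.exists_sub_eq (hf : IsIsoCycle G q f) {a b : ZMod q} {m : ℕ}
    (p : G.Walk (f a) (f b)) (hp : p.length ≤ m) : ∃ c : ℤ, |c| ≤ m ∧ a - b = c := by
  have : NeZero q := ⟨by have := hf.1; omega⟩
  exact exists_intCast_eq_sub_of_cycleDist_le (hf.2 a b ▸ (dist_le p).trans hp)

/-- The indices of two neighbors on an isometric cycle of a vertex differ by `0` or `±2`. -/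
theorem IsIsoCycle.sub_eq_of_adj (hf : IsIsoCycle G q f) (hg : 3 < G.girth) {v : V}
    {a b : ZMod q} (ha : G.Adj v (f a)) (hb : G.Adj v (f b)) :
    ∃ c : ℤ, (c = 0 ∨ c = 2 ∨ c = -2) ∧ a - b = c := by
  obtain ⟨c, hc, hab⟩ := hf.exists_sub_eq (m := 2) (.cons ha.symm (.cons hb .nil)) (by simp)
  refine ⟨c, ?_, hab⟩
  have hnadj := not_adj_of_three_lt_girth hg ha hb
  have h₁ : c ≠ 1 := by
    rintro rfl
    rw [show a = b + 1 by rw [← sub_eq_iff_eq_add', hab]; simp] at hnadj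
    exact hnadj (hf.adj_add_one b).symm
  have h₂ : c ≠ -1 := by
    rintro rfl
    rw [show a = b - 1 by rw [sub_eq_add_neg, ← sub_eq_iff_eq_add', hab]; simp] at hnadj
    exact hnadj (hf.adj_sub_one b).symm
  rw [abs_le] at hc
  omega

/-- The vertices adjacent to both cycle neighbors of the cycle vertex `f i`. -/
def cyclePart (G : SimpleGraph V) (f : ZMod q → V) (i : ZMod q) : Set V :=
  {v | G.Adj v (f (i - 1)) ∧ G.Adj v (f (i + 1))}

theorem IsIsoCycle.mem_cyclePart (hf : IsIsoCycle G q f) (i : ZMod q) :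
    f i ∈ cyclePart G f i :=
  ⟨hf.adj_sub_one i, hf.adj_add_one i⟩

theorem IsIsoCycle.eq_of_mem_cyclePart (hf : IsIsoCycle G q f) (hg : 3 < G.girth) (hq : 9 < q)
    {v : V} {i j : ZMod q} (hi : v ∈ cyclePart G f i) (hj : v ∈ cyclePart G f j) : i = j := by
  obtain ⟨c, hc, hij⟩ := hf.sub_eq_of_adj hg hi.2 hj.2
  obtain ⟨d, hd, hij'⟩ := hf.sub_eq_of_adj hg hi.2 hj.1
  obtain ⟨e, he, hij''⟩ := hf.sub_eq_of_adj hg hi.1 hj.2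
  have hdc : d = c + 2 := by
    apply intCast_zmod_inj_of_abs_sub_lt (q := q)
    · rw [abs_lt]; omega
    · push_cast; rw [← hij, ← hij']; ring
  have hec : e = c - 2 := by
    apply intCast_zmod_inj_of_abs_sub_lt (q := q)
    · rw [abs_lt]; omega
    · push_cast; rw [← hij, ← hij'']; ring
  obtain rfl : c = 0 := by omega
  rw [← sub_eq_zero]
  simpa using hij

theorem IsIsoCycle.sub_eq_of_adj_of_mem_cyclePart (hf : IsIsoCycle G q f) (hg : 3 < G.girth)
    (hq : 9 < q) {v w : V} {i j : ZMod q} (hi : v ∈ cyclePart G f i)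
    (hj : w ∈ cyclePart G f j) (hvw : G.Adj v w) : j = i + 1 ∨ j = i - 1 := by
  obtain ⟨c, hc, hij⟩ := hf.exists_sub_eq (m := 3)
    (.cons hi.2.symm (.cons hvw (.cons hj.2 .nil))) (by simp)
  obtain ⟨d, hd, hij'⟩ := hf.exists_sub_eq (m := 3)
    (.cons hi.2.symm (.cons hvw (.cons hj.1 .nil))) (by simp)
  obtain ⟨e, he, hij''⟩ := hf.exists_sub_eq (m := 3)
    (.cons hi.1.symm (.cons hvw (.cons hj.2 .nil))) (by simp)
  rw [abs_le] at hc hd he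
  have hdc : d = c + 2 := by
    apply intCast_zmod_inj_of_abs_sub_lt (q := q)
    · rw [abs_lt]; omega
    · push_cast; rw [← hij, ← hij']; ring
  have hec : e = c - 2 := by
    apply intCast_zmod_inj_of_abs_sub_lt (q := q)
    · rw [abs_lt]; omega
    · push_cast; rw [← hij, ← hij'']; ring
  obtain rfl | rfl | rfl : c = 0 ∨ c = 1 ∨ c = -1 := by omega
  · obtain rfl : i = j := by rw [← sub_eq_zero]; simpa using hij
    exact absurd hvw.symm
      (not_adj_of_three_lt_girth hg hj.2.symm hi.2.symm)
  · right
    push_cast at hij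
    linear_combination -hij
  · left
    push_cast at hij
    linear_combination -hij

theorem IsIsoCycle.card_filter_adj_le_two [NeZero q] [DecidableRel G.Adj]
    (hf : IsIsoCycle G q f) (hg : 3 < G.girth) (hq : 9 < q) (v : V) :
    (Finset.univ.filter fun i ↦ G.Adj v (f i)).card ≤ 2 := by
  by_contra! h
  obtain ⟨a, b, c, ha, hb, hc, hab, hac, hbc⟩ := Finset.two_lt_card_iff.1 h
  simp only [Finset.mem_filter, Finset.mem_univ, true_and] at ha hb hc
  obtain ⟨x, hx, hab'⟩ := hf.sub_eq_of_adj hg ha hb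
  obtain ⟨y, hy, hbc'⟩ := hf.sub_eq_of_adj hg hb hc
  obtain ⟨z, hz, hac'⟩ := hf.sub_eq_of_adj hg ha hc
  have hx0 : x ≠ 0 := by rintro rfl; exact hab (sub_eq_zero.1 (by simpa using hab'))
  have hy0 : y ≠ 0 := by rintro rfl; exact hbc (sub_eq_zero.1 (by simpa using hbc'))
  have hz0 : z ≠ 0 := by rintro rfl; exact hac (sub_eq_zero.1 (by simpa using hac'))
  have : z = x + y := by
    apply intCast_zmod_inj_of_abs_sub_lt (q := q)
    · rw [abs_lt]; omega
    · push_cast; rw [← hab', ← hbc', ← hac']; ring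
  omega

/-- In a `δ`-regular graph of order `qδ/2`, every vertex lies in some part. -/
theorem IsIsoCycle.exists_mem_cyclePart [Finite V] (hf : IsIsoCycle G q f)
    (hg : 3 < G.girth) (hq : 9 < q) {δ : ℕ} (hreg : ∀ v, ndeg G v = δ)
    (hcard : 2 * Nat.card V = q * δ) (v : V) : ∃ i, v ∈ cyclePart G f i := by
  classical
  have : NeZero q := ⟨by omega⟩
  have := Fintype.ofFinite V
  have hle : ∀ w ∈ (Finset.univ : Finset V),
      (Finset.univ.filter fun i ↦ G.Adj w (f i)).card ≤ 2 :=
    fun w _ ↦ hf.card_filter_adj_le_two hg hq w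
  have hsum : ∑ w : V, (Finset.univ.filter fun i ↦ G.Adj w (f i)).card = ∑ _w : V, 2 := by
    have hswap := Finset.sum_card_bipartiteAbove_eq_sum_card_bipartiteBelow
      (s := (Finset.univ : Finset V)) (t := Finset.univ) fun w i ↦ G.Adj w (f i)
    have hdeg : ∀ i : ZMod q,
        (Finset.univ.bipartiteBelow (fun w i ↦ G.Adj w (f i)) i : Finset V).card = δ := by
      intro i
      rw [← hreg (f i), ndeg, ← Set.ncard_coe_finset]
      congr 1
      ext w
      simp [G.adj_comm w]
    simp only [hdeg, Finset.sum_const, Finset.card_univ, ZMod.card, smul_eq_mul] at hswap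
    rw [Finset.sum_const, Finset.card_univ, smul_eq_mul, ← Nat.card_eq_fintype_card, mul_comm,
      hcard]
    exact hswap
  have htwo := (Finset.sum_eq_sum_iff_of_le hle).1 hsum v (Finset.mem_univ v)
  obtain ⟨a, b, hab, hset⟩ := Finset.card_eq_two.1 htwo
  have ha : G.Adj v (f a) := by
    have : a ∈ Finset.univ.filter fun i ↦ G.Adj v (f i) := by simp [hset]
    simpa using this
  have hb : G.Adj v (f b) := by
    have : b ∈ Finset.univ.filter fun i ↦ G.Adj v (f i) := by simp [hset]
    simpa using this
  obtain ⟨c, rfl | rfl | rfl, hc⟩ := hf.sub_eq_of_adj hg ha hb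
  · exact absurd (sub_eq_zero.1 (by simpa using hc)) hab
  · push_cast at hc
    refine ⟨b + 1, by simpa using hb, ?_⟩
    rwa [show b + 1 + 1 = a by linear_combination -hc]
  · push_cast at hc
    refine ⟨a + 1, by simpa using ha, ?_⟩
    rwa [show a + 1 + 1 = b by linear_combination hc]

theorem IsIsoCycle.disjoint_cyclePart (hf : IsIsoCycle G q f) (hg : 3 < G.girth) (hq : 9 < q)
    {i j : ZMod q} (hij : i ≠ j) : Disjoint (cyclePart G f i) (cyclePart G f j) :=
  Set.disjoint_left.2 fun _ hi hj ↦ hij (hf.eq_of_mem_cyclePart hg hq hi hj)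

theorem IsIsoCycle.neighborSet_subset (hf : IsIsoCycle G q f) (hg : 3 < G.girth) (hq : 9 < q)
    (hex : ∀ v, ∃ i, v ∈ cyclePart G f i) {v : V} {i : ZMod q} (hv : v ∈ cyclePart G f i) :
    G.neighborSet v ⊆ cyclePart G f (i - 1) ∪ cyclePart G f (i + 1) := by
  intro w hw
  obtain ⟨j, hj⟩ := hex w
  rcases hf.sub_eq_of_adj_of_mem_cyclePart hg hq hv hj hw with rfl | rfl
  · exact .inr hj
  · exact .inl hj

theorem IsIsoCycle.neighborSet_apply (hf : IsIsoCycle G q f) (hg : 3 < G.girth) (hq : 9 < q)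
    (hex : ∀ v, ∃ i, v ∈ cyclePart G f i) (i : ZMod q) :
    G.neighborSet (f i) = cyclePart G f (i - 1) ∪ cyclePart G f (i + 1) := by
  refine (hf.neighborSet_subset hg hq hex (hf.mem_cyclePart i)).antisymm ?_
  rintro w (hw | hw)
  · simpa using hw.2.symm
  · simpa using hw.1.symm

theorem IsIsoCycle.neighborSet_eq [Finite V] (hf : IsIsoCycle G q f) (hg : 3 < G.girth)
    (hq : 9 < q) (hex : ∀ v, ∃ i, v ∈ cyclePart G f i) {δ : ℕ} (hreg : ∀ v, ndeg G v = δ)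
    {v : V} {i : ZMod q} (hv : v ∈ cyclePart G f i) :
    G.neighborSet v = cyclePart G f (i - 1) ∪ cyclePart G f (i + 1) := by
  refine Set.eq_of_subset_of_ncard_le (hf.neighborSet_subset hg hq hex hv) ?_
  rw [← hf.neighborSet_apply hg hq hex]
  exact ((hreg (f i)).trans (hreg v).symm).le

theorem IsIsoCycle.ncard_add_ncard [Finite V] (hf : IsIsoCycle G q f) (hg : 3 < G.girth)
    (hq : 9 < q) (hex : ∀ v, ∃ i, v ∈ cyclePart G f i) {δ : ℕ} (hreg : ∀ v, ndeg G v = δ)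
    (i : ZMod q) : (cyclePart G f i).ncard + (cyclePart G f (i + 2)).ncard = δ := by
  have hne : i ≠ i + 2 := by
    intro h
    have h2 : ((2 : ℤ) : ZMod q) = (0 : ℤ) := by
      push_cast
      linear_combination -h
    have := intCast_zmod_inj_of_abs_sub_lt (by simp; omega) h2
    omega
  rw [← Set.ncard_union_eq (hf.disjoint_cyclePart hg hq hne), ← hreg (f (i + 1)), ndeg,
    hf.neighborSet_apply hg hq hex]
  congr 3 <;> ring_nf

end IsoCycle

section Periodic

variable {q δ : ℕ} {a : ZMod q → ℕ}

theorem apply_add_four_mul (h : ∀ i, a i + a (i + 2) = δ) (i : ZMod q) (k : ℕ) :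
    a (i + (4 * k : ℕ)) = a i := by
  induction k with
  | zero => simp
  | succ k ih =>
    have h₁ := h (i + (4 * k : ℕ))
    have h₂ := h (i + (4 * k : ℕ) + 2)
    rw [show i + ((4 * (k + 1) : ℕ) : ZMod q) = i + (4 * k : ℕ) + 2 + 2 by push_cast; ring]
    omega

theorem two_mul_apply_of_mod_four_ne_zero (h : ∀ i, a i + a (i + 2) = δ) (hq : q % 4 ≠ 0)
    (i : ZMod q) : 2 * a i = δ := by
  obtain ⟨k, hk⟩ : ∃ k : ℕ, ((4 * k : ℕ) : ZMod q) = 2 := by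
    rcases Nat.even_or_odd q with he | ho
    · refine ⟨(q + 2) / 4, ?_⟩
      rw [show 4 * ((q + 2) / 4) = q + 2 by rw [Nat.even_iff] at he; omega]
      simp
    · refine ⟨(q + 1) / 2, ?_⟩
      rw [show 4 * ((q + 1) / 2) = q + q + 2 by rw [Nat.odd_iff] at ho; omega]
      simp
  have h₁ := apply_add_four_mul h i k
  rw [hk] at h₁
  have := h i
  omega

theorem apply_natCast_eq_mod_four (h : ∀ i, a i + a (i + 2) = δ) (n : ℕ) :
    a n = a ((n % 4 : ℕ) : ZMod q) := by
  conv_lhs => rw [← Nat.mod_add_div n 4, Nat.cast_add]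
  exact apply_add_four_mul h _ _

end Periodic

/-- Theorem 7.2: characterization of equatorial graphs with girth 4. -/
theorem stmt_19 {V : Type*} (G : SimpleGraph V) (δ q : ℕ)
    (hG : IsEquatorial G δ 4 q) (hreg : ∀ v : V, ndeg G v = δ) :
    (q % 4 = 0 ∨ δ % 2 = 0) ∧
    ∃ L : ZMod q → Set V,
      (∀ v : V, ∃! i : ZMod q, v ∈ L i) ∧
      (∀ i : ZMod q, ∀ u ∈ L i, ∀ v ∈ L i, ¬ G.Adj u v) ∧
      (∀ u v : V, G.Adj u v ↔
        ∃ i : ZMod q, (u ∈ L i ∧ v ∈ L (i + 1)) ∨ (v ∈ L i ∧ u ∈ L (i + 1))) ∧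
      (q % 4 = 0 → ∃ n0 n1 n2 n3 : ℕ, 0 < n0 ∧ 0 < n1 ∧ 0 < n2 ∧ 0 < n3 ∧
        n0 + n2 = δ ∧ n1 + n3 = δ ∧
        ∀ i : ℕ, i < q →
          ((i % 4 = 0 → (L (i : ZMod q)).ncard = n0) ∧
           (i % 4 = 1 → (L (i : ZMod q)).ncard = n1) ∧
           (i % 4 = 2 → (L (i : ZMod q)).ncard = n2) ∧
           (i % 4 = 3 → (L (i : ZMod q)).ncard = n3))) ∧
      (q % 4 ≠ 0 → ∀ i : ZMod q, 2 * (L i).ncard = δ) := by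
  obtain ⟨hfin, -, hgirth, -, ⟨hcyc, -⟩, hq, hcard⟩ := hG
  replace hq : 9 < q := hq
  have hg : 3 < G.girth := by omega
  obtain ⟨f, hf⟩ : HasIsoCycle G q := hcyc.resolve_right fun h ↦ by omega
  have hδ : 0 < δ := by
    rw [← hreg (f 0), ndeg, Set.ncard_pos]
    exact ⟨f (0 + 1), hf.adj_add_one 0⟩
  have hmoore : mooreBound δ 4 = 2 * δ := by
    simp [mooreBound, show ¬ Odd 4 by decide]
    omega
  have hcard' : 2 * Nat.card V = q * δ := by
    rw [hmoore] at hcard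
    linarith
  have hex := hf.exists_mem_cyclePart hg hq hreg hcard'
  have hsum := hf.ncard_add_ncard hg hq hex hreg
  have hpos : ∀ i, 0 < (cyclePart G f i).ncard := fun i ↦
    (Set.ncard_pos).2 ⟨f i, hf.mem_cyclePart i⟩
  have hhalf := two_mul_apply_of_mod_four_ne_zero hsum
  refine ⟨?_, cyclePart G f, ?_, ?_, ?_, ?_, hhalf⟩
  · by_cases h : q % 4 = 0
    · exact .inl h
    · have := hhalf h 0
      omega
  · intro v
    obtain ⟨i, hi⟩ := hex v
    exact ⟨i, hi, fun j hj ↦ hf.eq_of_mem_cyclePart hg hq hj hi⟩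
  · intro i u hu v hv
    exact not_adj_of_three_lt_girth hg hu.2.symm hv.2.symm
  · intro u v
    constructor
    · intro huv
      obtain ⟨i, hi⟩ := hex u
      rcases hf.neighborSet_subset hg hq hex hi huv with hv | hv
      · exact ⟨i - 1, .inr ⟨hv, by simpa using hi⟩⟩
      · exact ⟨i, .inl ⟨hi, hv⟩⟩
    · have hadj : ∀ {i x y}, x ∈ cyclePart G f i → y ∈ cyclePart G f (i + 1) → G.Adj x y := by
        intro i x y hx hy
        rw [← mem_neighborSet, hf.neighborSet_eq hg hq hex hreg hx]
        exact .inr hy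
      rintro ⟨i, ⟨hu, hv⟩ | ⟨hv, hu⟩⟩
      · exact hadj hu hv
      · exact (hadj hv hu).symm
  · intro _
    refine ⟨_, _, _, _, hpos (0 : ℕ), hpos (1 : ℕ), hpos (2 : ℕ), hpos (3 : ℕ), ?_, ?_, ?_⟩
    · simpa using hsum 0
    · convert hsum 1 using 4 <;> push_cast <;> ring
    · intro i _
      have hi := apply_natCast_eq_mod_four hsum i
      refine ⟨?_, ?_, ?_, ?_⟩ <;> intro h <;> rw [hi, h]
end
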